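/- Let d ≥ 1, m ≥ 2d+3, 1 < v < m, and let F ⊆ [m]∖{v} be a 2d-subset. Then: F is a lower facet of the vertex figure C(m,2d+1)∖v if and only if #{a∈F : b<a<v} is even for all b∈[v−1]∖F and #{a∈F : v<a<b} is odd for all b∈[v+1,m]∖F; and F is an upper facet of C(m,2d+1)∖v if and only if #{a∈F : b<a<v} is odd for all b∈[v−1]∖F and #{a∈F : v<a<b} is even for all b∈[v+1,m]∖F. -/

import Mathlib

open scoped Classical

namespace HST

/-- `AltChain l₁ l₂` holds when the alternating merge of the two lists, starting with the
head of `l₁`, is strictly increasing: `a₀ < b₀ < a₁ < b₁ < ⋯`.  The lengths must satisfy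
`l₂.length ≤ l₁.length ≤ l₂.length + 1`. -/
def AltChain : List ℚ → List ℚ → Prop
  | [], [] => True
  | [], _ :: _ => False
  | [_], [] => True
  | _ :: _ :: _, [] => False
  | a :: as, b :: bs => a < b ∧ AltChain (b :: bs) as
termination_by l₁ l₂ => l₁.length + l₂.length
decreasing_by simp; omega

/-- The alternating merge starting with the least element of `A`. -/
def Intertwines (A B : Finset ℚ) : Prop :=
  AltChain (A.sort (· ≤ ·)) (B.sort (· ≤ ·))

/-- The paper's intertwining relation `A ≀ B`: for `#A = #B = k + 1` it means
`a₀ < b₀ < a₁ < b₁ < ⋯ < a_k < b_k`; for `#A = #B - 1` it means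
`b₀ < a₀ < b₁ < a₁ < ⋯ < b_k`. -/
def Wr (A B : Finset ℚ) : Prop :=
  if A.card = B.card then Intertwines A B else Intertwines B A

/-- Gale's evenness criterion: upper facets of the cyclic polytope with vertex set `V`. -/
def IsUpperFacet (V : Finset ℚ) (n : ℕ) (F : Finset ℚ) : Prop :=
  F ⊆ V ∧ F.card = n ∧ ∀ w ∈ V \ F, Odd ((F.filter fun x => w < x).card)

/-- Gale's evenness criterion: lower facets of the cyclic polytope with vertex set `V`. -/
def IsLowerFacet (V : Finset ℚ) (n : ℕ) (F : Finset ℚ) : Prop :=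
  F ⊆ V ∧ F.card = n ∧ ∀ w ∈ V \ F, Even ((F.filter fun x => w < x).card)

def IsFacet (V : Finset ℚ) (n : ℕ) (F : Finset ℚ) : Prop :=
  IsUpperFacet V n F ∨ IsLowerFacet V n F

/-- The circuits of the cyclic polytope `C(V, n)`. -/
def IsCircuit (V : Finset ℚ) (n : ℕ) (Zp Zm : Finset ℚ) : Prop :=
  Zp ⊆ V ∧ Zm ⊆ V ∧
    ((Zp.card = n / 2 + 1 ∧ Zm.card = (n + 1) / 2 + 1 ∧ Wr Zp Zm) ∨
      (Zm.card = n / 2 + 1 ∧ Zp.card = (n + 1) / 2 + 1 ∧ Wr Zm Zp))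

/-- Combinatorial triangulations of the cyclic polytope `C(V, n)`. -/
def IsTriangulation (V : Finset ℚ) (n : ℕ) (T : Finset (Finset ℚ)) : Prop :=
  (∀ S ∈ T, S ⊆ V ∧ S.card = n + 1) ∧
    (∀ S ∈ T, ∀ F ⊆ S, F.card = n →
      (∃ G, IsFacet V n G ∧ F ⊆ G) ∨ ∃ R ∈ T, R ≠ S ∧ F ⊆ R) ∧
    (∀ S ∈ T, ∀ R ∈ T, ∀ Zp Zm, IsCircuit V n Zp Zm → ¬(Zp ⊆ S ∧ Zm ⊆ R))

noncomputable def lowerFacets (V : Finset ℚ) (n : ℕ) : Finset (Finset ℚ) :=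
  V.powerset.filter fun F => IsLowerFacet V n F

noncomputable def upperFacets (V : Finset ℚ) (n : ℕ) : Finset (Finset ℚ) :=
  V.powerset.filter fun F => IsUpperFacet V n F

/-- `T'` is an increasing bistellar flip of `T`. -/
def IsIncFlip (V : Finset ℚ) (n : ℕ) (T T' : Finset (Finset ℚ)) : Prop :=
  ∃ U, U ⊆ V ∧ U.card = n + 2 ∧ lowerFacets U (n + 1) ⊆ T ∧
    T' = (T \ lowerFacets U (n + 1)) ∪ upperFacets U (n + 1)

/-- The first higher Stasheff–Tamari order. -/
def Le1 (V : Finset ℚ) (n : ℕ) : Finset (Finset ℚ) → Finset (Finset ℚ) → Prop :=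
  Relation.ReflTransGen (IsIncFlip V n)

/-- `simp(T)`: the internal `⌊n/2⌋`-simplices of a triangulation `T` of `C(V, n)`. -/
noncomputable def internalSimps (V : Finset ℚ) (n : ℕ) (T : Finset (Finset ℚ)) :
    Finset (Finset ℚ) :=
  V.powerset.filter fun A =>
    A.card = n / 2 + 1 ∧ (∃ S ∈ T, A ⊆ S) ∧ ∀ F, IsFacet V n F → ¬A ⊆ F

/-- The second higher Stasheff–Tamari order in even dimension `n = 2d`. -/
def Le2Even (V : Finset ℚ) (d : ℕ) (T T' : Finset (Finset ℚ)) : Prop :=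
  ∀ A ∈ internalSimps V (2 * d) T, ∀ B ∈ internalSimps V (2 * d) T', ¬Wr B A

/-- The second higher Stasheff–Tamari order in odd dimension `n = 2d + 1`. -/
def Le2Odd (V : Finset ℚ) (d : ℕ) (T T' : Finset (Finset ℚ)) : Prop :=
  internalSimps V (2 * d + 1) T' ⊆ internalSimps V (2 * d + 1) T

/-- The second higher Stasheff–Tamari order. -/
def Le2 (V : Finset ℚ) (n : ℕ) (T T' : Finset (Finset ℚ)) : Prop :=
  if Even n then ∀ A ∈ internalSimps V n T, ∀ B ∈ internalSimps V n T', ¬Wr B A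
  else internalSimps V n T' ⊆ internalSimps V n T

/-- The vertex set `[m] = {1, …, m}`, realised inside `ℚ`. -/
noncomputable def vSet (m : ℕ) : Finset ℚ := (Finset.Icc 1 m).image fun i => (i : ℚ)

/-- `C(U, n)` is a subpolytope of the triangulation `T`. -/
def IsSubpolytope (n : ℕ) (T : Finset (Finset ℚ)) (U : Finset ℚ) : Prop :=
  IsTriangulation U n (T.filter fun S => S ⊆ U)

/-- Contraction of a triangulation along a vertex map `c`. -/
noncomputable def contractTri (c : ℚ → ℚ) (n : ℕ) (T : Finset (Finset ℚ)) :
    Finset (Finset ℚ) :=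
  (T.image fun S => S.image c).filter fun S => S.card = n + 1

/-- The vertex map of the contraction `[m - 1 ← m]`. -/
def topMap (m : ℚ) (a : ℚ) : ℚ := if a = m then m - 1 else a

/-- The vertex map of the contraction `[1 → 2]`. -/
def botMap (a : ℚ) : ℚ := if a = 1 then 2 else a

/-- The vertex `x` of `[N]_{v+}`, realised in `ℚ`. -/
def xOf (v : ℕ) : ℚ := (v : ℚ) - 1/3

/-- The vertex `y` of `[N]_{v+}`, realised in `ℚ`. -/
def yOf (v : ℕ) : ℚ := (v : ℚ) + 1/3

/-- The vertex set `[N]_{v+} = {1, …, v - 1, x, y, v + 1, …, N}`. -/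
noncomputable def vPlus (N v : ℕ) : Finset ℚ :=
  insert (xOf v) (insert (yOf v) ((vSet N).erase (v : ℚ)))

/-- The vertex map of the contraction `[x → v ← y]`. -/
def midMap (v : ℕ) (a : ℚ) : ℚ := if a = xOf v ∨ a = yOf v then (v : ℚ) else a

/-- `U_{v+}` for a subset `U` of `[N]`. -/
noncomputable def setVPlus (v : ℕ) (U : Finset ℚ) : Finset ℚ :=
  if (v : ℚ) ∈ U then insert (xOf v) (insert (yOf v) (U.erase (v : ℚ))) else U

/-- `I(m, d)`: the internal `d`-simplices of `C(m, 2d)`. -/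
noncomputable def Iset (m d : ℕ) : Finset (Finset ℚ) :=
  (vSet m).powerset.filter fun A =>
    A.card = d + 1 ∧ (∀ a ∈ A, a + 1 ∉ A) ∧ ¬((1 : ℚ) ∈ A ∧ (m : ℚ) ∈ A)

/-- `O(m, d)`: the internal `d`-simplices of `C(m, 2d + 1)`. -/
noncomputable def Oset (m d : ℕ) : Finset (Finset ℚ) :=
  (Iset m d).filter fun A => (1 : ℚ) ∉ A ∧ (m : ℚ) ∉ A


/-- `G` decomposes as a disjoint union of pairs of consecutive numbers, with pair-starts
`P`, together with the endpoint `e ∈ {1, m}`. -/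
def PairDecomp (m : ℕ) (G P : Finset ℚ) (e : ℚ) : Prop :=
  (e = 1 ∨ e = (m : ℚ)) ∧ (∀ p ∈ P, p + 1 ∉ P) ∧
    e ∉ P ∧ e ∉ P.image (fun p => p + 1) ∧
    G = insert e (P ∪ P.image fun p => p + 1)

/-- `F` is a lower facet of the vertex figure `C(m, n) ∖ v`: `F ∪ {v}` is a facet of
`C(m, n)` in which `v` is paired with `v + 1`. -/
def VFLowerFacet (m : ℕ) (v : ℚ) (n : ℕ) (F : Finset ℚ) : Prop :=
  v ∉ F ∧ IsFacet (vSet m) n (insert v F) ∧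
    ∃ P e, PairDecomp m (insert v F) P e ∧ v ∈ P

/-- `F` is an upper facet of the vertex figure `C(m, n) ∖ v`: `F ∪ {v}` is a facet of
`C(m, n)` in which `v` is paired with `v - 1`. -/
def VFUpperFacet (m : ℕ) (v : ℚ) (n : ℕ) (F : Finset ℚ) : Prop :=
  v ∉ F ∧ IsFacet (vSet m) n (insert v F) ∧
    ∃ P e, PairDecomp m (insert v F) P e ∧ v - 1 ∈ P

theorem mem_vSet {m : ℕ} {x : ℚ} : x ∈ vSet m ↔ ∃ k : ℕ, 1 ≤ k ∧ k ≤ m ∧ (k : ℚ) = x := by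
  simp [vSet, and_assoc]

theorem card_filter_eq_add {s : Finset ℚ} {p q r : ℚ → Prop} [DecidablePred p]
    [DecidablePred q] [DecidablePred r]
    (h : ∀ x ∈ s, p x ↔ q x ∨ r x) (hd : ∀ x ∈ s, q x → ¬r x) :
    (s.filter p).card = (s.filter q).card + (s.filter r).card := by
  rw [← Finset.card_union_of_disjoint (Finset.disjoint_filter.2 hd), ← Finset.filter_or,
    Finset.filter_congr h]

theorem card_filter_eq_add_one {s : Finset ℚ} {p q : ℚ → Prop} [DecidablePred p]
    [DecidablePred q] {w : ℚ} (hw : w ∈ s)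
    (h : ∀ x ∈ s, p x ↔ q x ∨ x = w) (hd : ¬q w) :
    (s.filter p).card = (s.filter q).card + 1 := by
  rw [card_filter_eq_add (r := fun x => x = w) h (by rintro x - hx rfl; exact hd hx)]
  rw [Finset.filter_eq', if_pos hw, Finset.card_singleton]

theorem card_lt_add_card_gt {s : Finset ℚ} {w : ℚ} (hw : w ∉ s) :
    (s.filter fun x => x < w).card + (s.filter fun x => w < x).card = s.card := by
  rw [← card_filter_eq_add (p := fun _ => True), Finset.filter_true]
  · intro x hx
    have : x ≠ w := by rintro rfl; exact hw hx
    simpa using this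
  · intro x _ h
    exact not_lt.2 h.le

theorem lt_add_one_iff_of_mem_vSet {m : ℕ} {x y : ℚ} (hx : x ∈ vSet m) (hy : y ∈ vSet m) :
    x < y + 1 ↔ x < y ∨ x = y := by
  obtain ⟨i, -, -, rfl⟩ := mem_vSet.1 hx
  obtain ⟨j, -, -, rfl⟩ := mem_vSet.1 hy
  norm_cast
  omega

theorem add_one_mem_vSet {m : ℕ} {x : ℚ} (hx : x ∈ vSet m) (hm : x ≠ m) :
    x + 1 ∈ vSet m := by
  obtain ⟨i, h1, h2, rfl⟩ := mem_vSet.1 hx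
  refine mem_vSet.2 ⟨i + 1, by omega, ?_, by push_cast; rfl⟩
  have : i ≠ m := by exact_mod_cast hm
  omega

theorem sub_one_mem_vSet {m : ℕ} {x : ℚ} (hx : x ∈ vSet m) (h : x ≠ 1) :
    x - 1 ∈ vSet m := by
  obtain ⟨i, h1, h2, rfl⟩ := mem_vSet.1 hx
  have : i ≠ 1 := by exact_mod_cast h
  refine mem_vSet.2 ⟨i - 1, by omega, by omega, ?_⟩
  push_cast [h1]
  rfl

theorem card_lt_add_one_of_mem {m : ℕ} {G : Finset ℚ} (hG : G ⊆ vSet m) {x : ℚ}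
    (hx : x ∈ G) :
    (G.filter fun y => y < x + 1).card = (G.filter fun y => y < x).card + 1 :=
  card_filter_eq_add_one hx (fun _ hy => lt_add_one_iff_of_mem_vSet (hG hy) (hG hx)) (lt_irrefl x)

theorem card_lt_add_one_of_notMem {m : ℕ} {G : Finset ℚ} (hG : G ⊆ vSet m) {x : ℚ}
    (hx : x ∈ vSet m) (hxG : x ∉ G) :
    (G.filter fun y => y < x + 1).card = (G.filter fun y => y < x).card := by
  congr 1
  refine Finset.filter_congr fun y hy => ?_
  have : y ≠ x := by rintro rfl; exact hxG hy
  simp [lt_add_one_iff_of_mem_vSet (hG hy) hx, this]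

theorem card_lt_one {m : ℕ} {G : Finset ℚ} (hG : G ⊆ vSet m) :
    (G.filter fun y => y < 1).card = 0 := by
  simp only [Finset.card_eq_zero, Finset.filter_eq_empty_iff, not_lt]
  intro y hy
  obtain ⟨i, h1, -, rfl⟩ := mem_vSet.1 (hG hy)
  exact_mod_cast h1

theorem card_gt_top {m : ℕ} {G : Finset ℚ} (hG : G ⊆ vSet m) :
    (G.filter fun y => (m : ℚ) < y).card = 0 := by
  simp only [Finset.card_eq_zero, Finset.filter_eq_empty_iff, not_lt]
  intro y hy
  obtain ⟨i, -, h1, rfl⟩ := mem_vSet.1 (hG hy)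
  exact_mod_cast h1

theorem card_lt_top {m : ℕ} {G : Finset ℚ} (hG : G ⊆ vSet m) (hm : (m : ℚ) ∈ G) :
    (G.filter fun y => y < (m : ℚ)).card + 1 = G.card := by
  rw [← card_filter_eq_add_one (p := fun _ => True) hm, Finset.filter_true]
  · intro y hy
    obtain ⟨i, -, h1, rfl⟩ := mem_vSet.1 (hG hy)
    norm_cast
    simp only [true_iff]
    omega
  · exact lt_irrefl _

/-- In a lower facet of odd size, the vertices preceded by an odd number of vertices are the
starts of the pairs, and `1` is the remaining vertex. -/
theorem IsLowerFacet.pairDecomp {m n : ℕ} {G : Finset ℚ} (h : IsLowerFacet (vSet m) n G)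
    (hn : Odd n) (hm : 1 ≤ m) :
    PairDecomp m G (G.filter fun p => Odd (G.filter fun x => x < p).card) 1 := by
  obtain ⟨hG, hc, hgap⟩ := h
  have gap : ∀ w ∈ vSet m, w ∉ G → Odd (G.filter fun x => x < w).card := by
    intro w hw hwG
    have h1 := hgap w (by simp [hw, hwG])
    have h2 := card_lt_add_card_gt hwG
    grind
  have h1G : (1 : ℚ) ∈ G := by
    by_contra h1
    have := gap 1 (mem_vSet.2 ⟨1, le_rfl, hm, by simp⟩) h1
    simp [card_lt_one hG] at this
  have hadd : ∀ p ∈ G, Odd (G.filter fun x => x < p).card → p + 1 ∈ G := by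
    intro p hp hodd
    by_contra hp1
    have hpm : p ≠ m := by
      rintro rfl
      have := card_lt_top hG hp
      grind
    have := gap _ (add_one_mem_vSet (hG hp) hpm) hp1
    rw [card_lt_add_one_of_mem hG hp] at this
    grind
  refine ⟨Or.inl rfl, ?_, ?_, ?_, ?_⟩
  · intro p hp hp1
    simp only [Finset.mem_filter] at hp hp1
    rw [card_lt_add_one_of_mem hG hp.1] at hp1
    grind
  · simp [card_lt_one hG]
  · simp only [Finset.mem_image, Finset.mem_filter, not_exists, not_and, and_imp]
    intro p hp _ hp1
    have := card_lt_add_one_of_mem hG hp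
    rw [hp1, card_lt_one hG] at this
    omega
  · ext g
    simp only [Finset.mem_insert, Finset.mem_union, Finset.mem_image, Finset.mem_filter]
    constructor
    · intro hg
      by_cases hg1 : g = 1
      · exact Or.inl hg1
      right
      by_cases ho : Odd (G.filter fun x => x < g).card
      · exact Or.inl ⟨hg, ho⟩
      right
      have hs := sub_one_mem_vSet (hG hg) hg1
      have hsG : g - 1 ∈ G := by
        by_contra hsG
        have h1 := gap _ hs hsG
        have h2 := card_lt_add_one_of_notMem hG hs hsG
        rw [sub_add_cancel] at h2
        exact ho (h2 ▸ h1)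
      have h2 := card_lt_add_one_of_mem hG hsG
      rw [sub_add_cancel] at h2
      exact ⟨g - 1, ⟨hsG, by grind⟩, sub_add_cancel _ _⟩
    · rintro (rfl | ⟨hg, -⟩ | ⟨p, ⟨hp, ho⟩, rfl⟩)
      · exact h1G
      · exact hg
      · exact hadd p hp ho

/-- In an upper facet of odd size, the vertices other than `m` preceded by an even number of
vertices are the starts of the pairs, and `m` is the remaining vertex. -/
theorem IsUpperFacet.pairDecomp {m n : ℕ} {G : Finset ℚ} (h : IsUpperFacet (vSet m) n G)
    (hn : Odd n) (hm : 1 ≤ m) :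
    PairDecomp m G
      (G.filter fun p => Even (G.filter fun x => x < p).card ∧ p ≠ (m : ℚ)) m := by
  obtain ⟨hG, hc, hgap⟩ := h
  have gap : ∀ w ∈ vSet m, w ∉ G → Even (G.filter fun x => x < w).card := by
    intro w hw hwG
    have h1 := hgap w (by simp [hw, hwG])
    have h2 := card_lt_add_card_gt hwG
    grind
  have hmG : (m : ℚ) ∈ G := by
    by_contra h1
    have := hgap m (by simp [h1, mem_vSet.2 ⟨m, hm, le_rfl, rfl⟩])
    simp [card_gt_top hG] at this
  have hadd : ∀ p ∈ G, Even (G.filter fun x => x < p).card → p ≠ m → p + 1 ∈ G := by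
    intro p hp hev hpm
    by_contra hp1
    have := gap _ (add_one_mem_vSet (hG hp) hpm) hp1
    rw [card_lt_add_one_of_mem hG hp] at this
    grind
  refine ⟨Or.inr rfl, ?_, ?_, ?_, ?_⟩
  · intro p hp hp1
    simp only [Finset.mem_filter] at hp hp1
    rw [card_lt_add_one_of_mem hG hp.1] at hp1
    grind
  · simp
  · simp only [Finset.mem_image, Finset.mem_filter, not_exists, not_and, and_imp]
    intro p hp _ _ hp1
    have h1 := card_lt_add_one_of_mem hG hp
    have h2 := card_lt_top hG hmG
    rw [hp1] at h1
    grind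
  · ext g
    simp only [Finset.mem_insert, Finset.mem_union, Finset.mem_image, Finset.mem_filter]
    constructor
    · intro hg
      by_cases hgm : g = m
      · exact Or.inl hgm
      right
      by_cases ho : Even (G.filter fun x => x < g).card
      · exact Or.inl ⟨hg, ho, hgm⟩
      right
      have hg1 : g ≠ 1 := by
        rintro rfl
        simp [card_lt_one hG] at ho
      have hs := sub_one_mem_vSet (hG hg) hg1
      have hsG : g - 1 ∈ G := by
        by_contra hsG
        have h1 := gap _ hs hsG
        have h2 := card_lt_add_one_of_notMem hG hs hsG
        rw [sub_add_cancel] at h2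
        exact ho (h2 ▸ h1)
      have h2 := card_lt_add_one_of_mem hG hsG
      rw [sub_add_cancel] at h2
      refine ⟨g - 1, ⟨hsG, by grind, ?_⟩, sub_add_cancel _ _⟩
      intro hgm'
      obtain ⟨k, -, hk, rfl⟩ := mem_vSet.1 (hG hg)
      have : (k : ℚ) ≤ m := by exact_mod_cast hk
      linarith
    · rintro (rfl | ⟨hg, -⟩ | ⟨p, ⟨hp, ho, hpm⟩, rfl⟩)
      · exact hmG
      · exact hg
      · exact hadd p hp ho hpm

/-- A region that avoids the unpaired vertex and separates no pair contains an even number of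
vertices. -/
theorem PairDecomp.even_card_filter {m : ℕ} {G P : Finset ℚ} {e : ℚ}
    (h : PairDecomp m G P e) {q : ℚ → Prop} [DecidablePred q] (he : ¬q e) (hq : ∀ p ∈ P, q p ↔ q (p + 1)) :
    Even (G.filter q).card := by
  obtain ⟨-, hP, -, -, rfl⟩ := h
  rw [Finset.filter_insert, if_neg he, Finset.filter_union, Finset.filter_image,
    Finset.card_union_of_disjoint, Finset.card_image_of_injective _ (add_left_injective 1),
    Finset.filter_congr hq]
  · exact ⟨_, rfl⟩
  · rw [Finset.disjoint_left]
    intro x hx hx'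
    obtain ⟨p, hp, rfl⟩ := Finset.mem_image.1 hx'
    exact hP p (Finset.mem_filter.1 hp).1 (Finset.mem_filter.1 hx).1

theorem PairDecomp.start_mem {m : ℕ} {G P : Finset ℚ} {e p : ℚ}
    (h : PairDecomp m G P e) (hp : p ∈ P) : p ∈ G := by
  rw [h.2.2.2.2]
  simp [hp]

theorem PairDecomp.start_add_one_mem {m : ℕ} {G P : Finset ℚ} {e p : ℚ}
    (h : PairDecomp m G P e) (hp : p ∈ P) : p + 1 ∈ G := by
  rw [h.2.2.2.2]
  simp [hp]

theorem PairDecomp.sub_one_mem {m : ℕ} {G P : Finset ℚ} {e x : ℚ}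
    (h : PairDecomp m G P e) (hx : x ∈ G) (he : x ≠ e) (hP : x ∉ P) : x - 1 ∈ P := by
  rw [h.2.2.2.2] at hx
  simp only [Finset.mem_insert, he, Finset.mem_union, hP, Finset.mem_image, false_or] at hx
  obtain ⟨p, hp, rfl⟩ := hx
  simpa using hp

/-- An open interval whose ends separate no pair contains an even number of vertices. -/
theorem PairDecomp.even_card_Ioo {m : ℕ} {G P : Finset ℚ} {e : ℚ}
    (h : PairDecomp m G P e) (hG : G ⊆ vSet m) {b c : ℚ} (hb : b ∈ vSet m) (hc : c ∈ vSet m)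
    (hbP : b ∉ P) (hcP : c - 1 ∉ P) :
    Even (G.filter fun a => b < a ∧ a < c).card := by
  refine h.even_card_filter ?_ fun p hp => ?_
  · obtain ⟨i, hi, -, rfl⟩ := mem_vSet.1 hb
    obtain ⟨j, -, hj, rfl⟩ := mem_vSet.1 hc
    have hi : (1 : ℚ) ≤ i := by exact_mod_cast hi
    have hj : (j : ℚ) ≤ m := by exact_mod_cast hj
    rintro ⟨h1, h2⟩
    rcases h.1 with rfl | rfl <;> linarith
  · have hbp : p ≠ b := by rintro rfl; exact hbP hp
    have hcp : c ≠ p + 1 := by rintro rfl; exact hcP (by simpa using hp)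
    obtain ⟨i, -, -, rfl⟩ := mem_vSet.1 hb
    obtain ⟨j, -, -, rfl⟩ := mem_vSet.1 hc
    obtain ⟨k, -, -, rfl⟩ := mem_vSet.1 (hG (h.start_mem hp))
    norm_cast at hbp hcp ⊢
    omega

theorem card_insert_filter {F : Finset ℚ} {w : ℚ} (hw : w ∉ F) {q : ℚ → Prop}
    [DecidablePred q] (hq : q w) :
    ((insert w F).filter q).card = (F.filter q).card + 1 := by
  rw [Finset.filter_insert, if_pos hq, Finset.card_insert_of_notMem]
  simp [hw]

theorem filter_insert_of_not {F : Finset ℚ} {w : ℚ} {q : ℚ → Prop}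
    [DecidablePred q] (hq : ¬q w) :
    (insert w F).filter q = F.filter q := by
  rw [Finset.filter_insert, if_neg hq]

theorem card_insert_gt_of_lt {F : Finset ℚ} {v b : ℚ} (hv : v ∉ F) (hb : b < v) :
    ((insert v F).filter fun x => b < x).card =
      (F.filter fun a => b < a ∧ a < v).card + (F.filter fun a => v < a).card + 1 := by
  rw [card_insert_filter hv hb]
  congr 1
  refine card_filter_eq_add (fun x hx => ?_) fun x _ h => not_lt.2 h.2.le
  have : x ≠ v := by rintro rfl; exact hv hx
  grind

theorem card_insert_gt_of_gt {F : Finset ℚ} {v b : ℚ} (hb : v < b) (hbF : b ∉ F) :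
    (F.filter fun a => v < a ∧ a < b).card + ((insert v F).filter fun x => b < x).card =
      (F.filter fun a => v < a).card := by
  rw [filter_insert_of_not (not_lt.2 hb.le)]
  refine (card_filter_eq_add (fun x hx => ?_) fun x _ h => not_lt.2 h.2.le).symm
  have : x ≠ b := by rintro rfl; exact hbF hx
  grind

theorem card_insert_Ioo_sub_one {m : ℕ} {F : Finset ℚ} (hF : F ⊆ vSet m) {v b : ℚ}
    (hvV : v ∈ vSet m) (hv : v ∉ F) (hb : v < b) :
    ((insert v F).filter fun a => v - 1 < a ∧ a < b).card =
      (F.filter fun a => v < a ∧ a < b).card + 1 := by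
  rw [card_insert_filter hv ⟨by linarith, hb⟩]
  congr 2
  ext a
  simp only [Finset.mem_filter, sub_lt_iff_lt_add]
  refine and_congr_right fun ha => and_congr_left fun _ => ?_
  have : v ≠ a := by rintro rfl; exact hv ha
  simp [lt_add_one_iff_of_mem_vSet hvV (hF ha), this]

theorem card_insert_Ioo_add_one {m : ℕ} {F : Finset ℚ} (hF : F ⊆ vSet m) {v b : ℚ}
    (hvV : v ∈ vSet m) (hv : v ∉ F) (hb : b < v) :
    ((insert v F).filter fun a => b < a ∧ a < v + 1).card =
      (F.filter fun a => b < a ∧ a < v).card + 1 := by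
  rw [card_insert_filter hv ⟨hb, by linarith⟩]
  congr 2
  ext a
  simp only [Finset.mem_filter]
  refine and_congr_right fun ha => and_congr_right fun _ => ?_
  have : a ≠ v := by rintro rfl; exact hv ha
  simp [lt_add_one_iff_of_mem_vSet (hF ha) hvV, this]

/-- **Lemma (generalised evenness criterion for vertex figures).** -/
theorem vf_facet_evenness (d m v : ℕ) (hd : 1 ≤ d) (hm : 2 * d + 3 ≤ m)
    (hv1 : 1 < v) (hvm : v < m)
    (F : Finset ℚ) (hF : F ⊆ (vSet m).erase (v : ℚ)) (hcard : F.card = 2 * d) :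
    (VFLowerFacet m (v : ℚ) (2 * d + 1) F ↔
      ((∀ b ∈ vSet m, b < (v : ℚ) → b ∉ F →
          Even ((F.filter fun a => b < a ∧ a < (v : ℚ)).card)) ∧
        (∀ b ∈ vSet m, (v : ℚ) < b → b ∉ F →
          Odd ((F.filter fun a => (v : ℚ) < a ∧ a < b).card)))) ∧
    (VFUpperFacet m (v : ℚ) (2 * d + 1) F ↔
      ((∀ b ∈ vSet m, b < (v : ℚ) → b ∉ F →
          Odd ((F.filter fun a => b < a ∧ a < (v : ℚ)).card)) ∧
        (∀ b ∈ vSet m, (v : ℚ) < b → b ∉ F →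
          Even ((F.filter fun a => (v : ℚ) < a ∧ a < b).card)))) := by
  have hFV : F ⊆ vSet m := hF.trans (Finset.erase_subset _ _)
  have hvV : (v : ℚ) ∈ vSet m := mem_vSet.2 ⟨v, hv1.le, hvm.le, rfl⟩
  have hvF : (v : ℚ) ∉ F := fun h => by simpa using hF h
  have hGV : insert (v : ℚ) F ⊆ vSet m := Finset.insert_subset hvV hFV
  have hGc : (insert (v : ℚ) F).card = 2 * d + 1 := by
    rw [Finset.card_insert_of_notMem hvF, hcard]
  have hv1' : (v : ℚ) ≠ 1 := by exact_mod_cast hv1.ne'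
  have hvm' : (v : ℚ) ≠ m := by exact_mod_cast hvm.ne
  have hrank : ((insert (v : ℚ) F).filter fun x => x < (v : ℚ)).card =
      (F.filter fun x => x < (v : ℚ)).card := by
    rw [filter_insert_of_not (q := fun x => x < (v : ℚ)) (lt_irrefl _)]
  have hsplit := card_lt_add_card_gt hvF
  have hn : Odd (2 * d + 1) := ⟨d, rfl⟩
  have notMem_start : ∀ {P : Finset ℚ} {e b : ℚ}, PairDecomp m (insert (v : ℚ) F) P e →
      b ≠ v → b ∉ F → b ∉ P := by
    intro P e b h hbv hbF hb
    simpa [hbv, hbF] using h.start_mem hb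
  have sub_one_notMem_start : ∀ {P : Finset ℚ} {e b : ℚ},
      PairDecomp m (insert (v : ℚ) F) P e → b ≠ v → b ∉ F → b - 1 ∉ P := by
    intro P e b h hbv hbF hb
    simpa [hbv, hbF] using h.start_add_one_mem hb
  have gaps : ∀ {Q : ℕ → Prop},
      (∀ b ∈ vSet m, b < (v : ℚ) → b ∉ F →
        Q ((insert (v : ℚ) F).filter fun x => b < x).card) →
      (∀ b ∈ vSet m, (v : ℚ) < b → b ∉ F →
        Q ((insert (v : ℚ) F).filter fun x => b < x).card) →
      ∀ b ∈ vSet m \ insert (v : ℚ) F, Q ((insert (v : ℚ) F).filter fun x => b < x).card := by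
    intro Q h1 h2 b hb
    simp only [Finset.mem_sdiff, Finset.mem_insert, not_or] at hb
    rcases lt_or_gt_of_ne hb.2.1 with hbv | hbv
    · exact h1 b hb.1 hbv hb.2.2
    · exact h2 b hb.1 hbv hb.2.2
  refine ⟨⟨?_, ?_⟩, ⟨?_, ?_⟩⟩
  · rintro ⟨-, -, P, e, h, hvP⟩
    have hv : (v : ℚ) - 1 ∉ P := fun h' => h.2.1 _ h' (by simpa using hvP)
    refine ⟨fun b hb hbv hbF => ?_, fun b hb hbv hbF => ?_⟩
    · have := h.even_card_Ioo hGV hb hvV (notMem_start h hbv.ne hbF) hv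
      rwa [filter_insert_of_not (by simp)] at this
    · have := h.even_card_Ioo hGV (sub_one_mem_vSet hvV hv1') hb hv
        (sub_one_notMem_start h hbv.ne' hbF)
      rw [card_insert_Ioo_sub_one hFV hvV hvF hbv] at this
      grind
  · rintro ⟨hlo, hhi⟩
    rcases Nat.even_or_odd (F.filter fun a => (v : ℚ) < a).card with hB | hB
    · have hG : IsUpperFacet (vSet m) (2 * d + 1) (insert (v : ℚ) F) := by
        refine ⟨hGV, hGc, gaps (fun b hb hbv hbF => ?_) fun b hb hbv hbF => ?_⟩
        · have h1 := card_insert_gt_of_lt hvF hbv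
          have h2 := hlo b hb hbv hbF
          grind
        · have h1 := card_insert_gt_of_gt hbv hbF
          have h2 := hhi b hb hbv hbF
          grind
      refine ⟨hvF, Or.inl hG, _, _, hG.pairDecomp hn (by omega), ?_⟩
      rw [Finset.mem_filter, hrank]
      exact ⟨Finset.mem_insert_self _ _, by grind, hvm'⟩
    · have hG : IsLowerFacet (vSet m) (2 * d + 1) (insert (v : ℚ) F) := by
        refine ⟨hGV, hGc, gaps (fun b hb hbv hbF => ?_) fun b hb hbv hbF => ?_⟩
        · have h1 := card_insert_gt_of_lt hvF hbv
          have h2 := hlo b hb hbv hbF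
          grind
        · have h1 := card_insert_gt_of_gt hbv hbF
          have h2 := hhi b hb hbv hbF
          grind
      refine ⟨hvF, Or.inr hG, _, _, hG.pairDecomp hn (by omega), ?_⟩
      rw [Finset.mem_filter, hrank]
      exact ⟨Finset.mem_insert_self _ _, by grind⟩
  · rintro ⟨-, -, P, e, h, hvP⟩
    have hv : (v : ℚ) ∉ P := fun h' => h.2.1 _ hvP (by simpa using h')
    refine ⟨fun b hb hbv hbF => ?_, fun b hb hbv hbF => ?_⟩
    · have := h.even_card_Ioo hGV hb (add_one_mem_vSet hvV hvm') (notMem_start h hbv.ne hbF)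
        (by simpa using hv)
      rw [card_insert_Ioo_add_one hFV hvV hvF hbv] at this
      grind
    · have := h.even_card_Ioo hGV hvV hb hv (sub_one_notMem_start h hbv.ne' hbF)
      rwa [filter_insert_of_not (by simp)] at this
  · rintro ⟨hlo, hhi⟩
    rcases Nat.even_or_odd (F.filter fun a => (v : ℚ) < a).card with hB | hB
    · have hG : IsLowerFacet (vSet m) (2 * d + 1) (insert (v : ℚ) F) := by
        refine ⟨hGV, hGc, gaps (fun b hb hbv hbF => ?_) fun b hb hbv hbF => ?_⟩
        · have h1 := card_insert_gt_of_lt hvF hbv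
          have h2 := hlo b hb hbv hbF
          grind
        · have h1 := card_insert_gt_of_gt hbv hbF
          have h2 := hhi b hb hbv hbF
          grind
      have hP := hG.pairDecomp hn (by omega)
      refine ⟨hvF, Or.inr hG, _, _, hP, hP.sub_one_mem (Finset.mem_insert_self _ _) hv1' ?_⟩
      rw [Finset.mem_filter, hrank]
      grind
    · have hG : IsUpperFacet (vSet m) (2 * d + 1) (insert (v : ℚ) F) := by
        refine ⟨hGV, hGc, gaps (fun b hb hbv hbF => ?_) fun b hb hbv hbF => ?_⟩
        · have h1 := card_insert_gt_of_lt hvF hbv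
          have h2 := hlo b hb hbv hbF
          grind
        · have h1 := card_insert_gt_of_gt hbv hbF
          have h2 := hhi b hb hbv hbF
          grind
      have hP := hG.pairDecomp hn (by omega)
      refine ⟨hvF, Or.inl hG, _, _, hP, hP.sub_one_mem (Finset.mem_insert_self _ _) hvm' ?_⟩
      rw [Finset.mem_filter, hrank]
      grind

end HST
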